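/- Let G be a finite connected weighted graph with root r and weight w : E → ℝ₊. Define for a spanning tree T rooted at r the flow of a vertex v as fw_T(v) = min over edges e on the tree path from r to v of w(e). Then a spanning tree T is a maximum-flow tree (fw_T(v) is maximal over all spanning trees, for every v) if and only if for every vertex v ≠ r, fw_T(v) = max over neighbors u of v in G of min(fw_T(u), w(u,v)). -/

import Mathlib

open scoped ENNReal

/-- The bottleneck of a walk: the minimum weight of an edge on it (`⊤` for the
trivial walk). -/
noncomputable def bottleneck {V : Type*} {G : SimpleGraph V} (w : Sym2 V → ℝ≥0∞)
    {u v : V} (p : G.Walk u v) : ℝ≥0∞ :=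
  (p.edges.map w).foldr min ⊤

/-- The flow from `r` to `v` in a graph `H`: the largest bottleneck of an
`r`–`v` path.  When `H` is a tree this is the bottleneck of the unique tree
path from `r` to `v` (and it equals `⊤` for `v = r`). -/
noncomputable def flowValue {V : Type*} (H : SimpleGraph V) (w : Sym2 V → ℝ≥0∞)
    (r v : V) : ℝ≥0∞ :=
  ⨆ p : {p : H.Walk r v // p.IsPath}, bottleneck w p.val

theorem le_bottleneck_iff {V : Type*} {G : SimpleGraph V} {w : Sym2 V → ℝ≥0∞} {u v : V}
    {p : G.Walk u v} {b : ℝ≥0∞} : b ≤ bottleneck w p ↔ ∀ e ∈ p.edges, b ≤ w e := by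
  unfold bottleneck
  induction p.edges with
  | nil => simp
  | cons e l ih => simp [ih]

theorem bottleneck_concat {V : Type*} {G : SimpleGraph V} (w : Sym2 V → ℝ≥0∞) {u v x : V}
    (p : G.Walk u v) (h : G.Adj v x) :
    bottleneck w (p.concat h) = min (bottleneck w p) (w s(v, x)) :=
  eq_of_forall_le_iff fun b => by
    simp [le_bottleneck_iff, SimpleGraph.Walk.edges_concat, or_imp, forall_and]

theorem bottleneck_le_flowValue {V : Type*} {H : SimpleGraph V} (w : Sym2 V → ℝ≥0∞)
    {r v : V} (p : H.Walk r v) : bottleneck w p ≤ flowValue H w r v := by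
  classical
  exact (le_bottleneck_iff.2 fun e he =>
    le_bottleneck_iff.1 le_rfl e (p.edges_bypass_subset_edges he)).trans
      (le_iSup (fun q : {q : H.Walk r v // q.IsPath} => bottleneck w q.val)
        ⟨p.bypass, p.bypass_isPath⟩)

theorem flowValue_self {V : Type*} (H : SimpleGraph V) (w : Sym2 V → ℝ≥0∞) (r : V) :
    flowValue H w r r = ⊤ :=
  top_le_iff.1 (bottleneck_le_flowValue w (SimpleGraph.Walk.nil : H.Walk r r))

theorem SimpleGraph.IsTree.exists_bottleneck_eq_flowValue {V : Type*} {T : SimpleGraph V}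
    (hT : T.IsTree) (w : Sym2 V → ℝ≥0∞) (r v : V) :
    ∃ p : T.Walk r v, bottleneck w p = flowValue T w r v := by
  obtain ⟨p, -, hp⟩ := hT.existsUnique_path r v
  refine ⟨p, (bottleneck_le_flowValue w p).antisymm (iSup_le fun q => ?_)⟩
  rw [hp q.val q.property]

/-- The bottleneck of a walk to `v ≠ r` is at most that of its last edge combined with the flow
of the penultimate vertex. -/
theorem bottleneck_le_iSup_neighborSet {V : Type*} {G H : SimpleGraph V} (hHG : H ≤ G)
    (w : Sym2 V → ℝ≥0∞) {r v : V} (p : H.Walk r v) (hv : v ≠ r) :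
    bottleneck w p ≤ ⨆ u ∈ G.neighborSet v, min (flowValue H w r u) (w s(u, v)) := by
  induction p using SimpleGraph.Walk.concatRec with
  | Hnil => exact absurd rfl hv
  | @Hconcat a b c q h _ =>
    rw [bottleneck_concat]
    exact (min_le_min_right _ (bottleneck_le_flowValue w q)).trans
      (le_iSup₂ (f := fun u (_ : u ∈ G.neighborSet c) => min (flowValue H w a u) (w s(u, c)))
        b (hHG h).symm)

/-- Every walk in a connected graph is matched by the flow of some spanning tree: extend a
spanning forest of the subgraph of heavy edges. -/
theorem SimpleGraph.Connected.exists_isTree_bottleneck_le_flowValue {V : Type*}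
    {G : SimpleGraph V} (hG : G.Connected) (w : Sym2 V → ℝ≥0∞) {r v : V} (p : G.Walk r v) :
    ∃ T ≤ G, T.IsTree ∧ bottleneck w p ≤ flowValue T w r v := by
  let K : SimpleGraph V := G.deleteEdges {e | w e < bottleneck w p}
  obtain ⟨F, hFK, hF, hreach⟩ := K.exists_isAcyclic_reachable_eq_le
  have hFG : F ≤ G := hFK.trans (G.deleteEdges_le _)
  obtain ⟨T, hFT, hTG, hT⟩ := hG.exists_isTree_le_of_le_of_isAcyclic hFG hF
  have hpK : ∀ e ∈ p.edges, e ∈ K.edgeSet := fun e he => by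
    rw [SimpleGraph.edgeSet_deleteEdges]
    exact ⟨p.edges_subset_edgeSet he, not_lt.2 (le_bottleneck_iff.1 le_rfl e he)⟩
  have hK : K.Reachable r v := ⟨p.transfer K hpK⟩
  rw [← hreach] at hK
  obtain ⟨q⟩ := hK
  refine ⟨T, hTG, hT, le_trans (le_bottleneck_iff.2 fun e he => ?_)
    (bottleneck_le_flowValue w (q.mapLe hFT))⟩
  rw [SimpleGraph.Walk.edges_mapLe_eq_edges] at he
  have heK := SimpleGraph.edgeSet_mono hFK (q.edges_subset_edgeSet he)
  rw [SimpleGraph.edgeSet_deleteEdges] at heK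
  exact not_lt.1 heK.2

/-- The recurrence forces the flow along any walk to be at least its bottleneck. -/
theorem min_flowValue_bottleneck_le {V : Type*} {G T : SimpleGraph V} {w : Sym2 V → ℝ≥0∞} {r : V}
    (h : ∀ v, v ≠ r → ∀ u, G.Adj v u → min (flowValue T w r u) (w s(u, v)) ≤ flowValue T w r v)
    {u v : V} (p : G.Walk u v) :
    min (flowValue T w r u) (bottleneck w p) ≤ flowValue T w r v := by
  induction p with
  | nil => exact min_le_left _ _
  | @cons a b c hab q ih =>
    refine le_trans (le_min ?_ ?_) ih
    · by_cases hb : b = r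
      · exact le_top.trans_eq (by rw [hb, flowValue_self])
      · exact (min_le_min_left _ (le_bottleneck_iff.1 le_rfl _ (by simp))).trans
          (h b hb a hab.symm)
    · exact (min_le_right _ _).trans (le_bottleneck_iff.2 fun e he =>
        le_bottleneck_iff.1 le_rfl e (by simp [he]))

/-- A spanning tree `T` of a finite connected weighted graph `G` is a
maximum-flow tree rooted at `r` (i.e. its flow `fw_T(v)` is maximal among all
spanning trees, simultaneously for every `v`) if and only if for every vertex
`v ≠ r`, `fw_T(v) = max_{u ~ v in G} min (fw_T(u), w(u,v))`. -/
theorem maxflow_tree_iff_recurrence {V : Type*} [Fintype V]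
    (G T : SimpleGraph V) (w : Sym2 V → ℝ≥0∞) (r : V)
    (hconn : G.Connected) (hTG : T ≤ G) (hT : T.IsTree) :
    (∀ (T' : SimpleGraph V), T' ≤ G → T'.IsTree →
        ∀ v, flowValue T' w r v ≤ flowValue T w r v) ↔
    (∀ v, v ≠ r →
        flowValue T w r v =
          ⨆ u ∈ G.neighborSet v, min (flowValue T w r u) (w s(u, v))) := by
  constructor
  · intro hmax v hv
    refine le_antisymm (iSup_le fun p => bottleneck_le_iSup_neighborSet hTG w p.val hv)
      (iSup₂_le fun u hu => ?_)
    obtain ⟨p, hp⟩ := hT.exists_bottleneck_eq_flowValue w r u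
    obtain ⟨T', hT'G, hT', hle⟩ := hconn.exists_isTree_bottleneck_le_flowValue w
      ((p.mapLe hTG).concat hu.symm)
    rw [bottleneck_concat, bottleneck, SimpleGraph.Walk.edges_mapLe_eq_edges, ← bottleneck, hp]
      at hle
    exact hle.trans (hmax T' hT'G hT' v)
  · intro hrec T' hT'G _ v
    refine iSup_le fun p => ?_
    have hle : ∀ v, v ≠ r → ∀ u, G.Adj v u →
        min (flowValue T w r u) (w s(u, v)) ≤ flowValue T w r v := fun v hv u hu => by
      rw [hrec v hv]
      exact le_iSup₂ (f := fun u (_ : u ∈ G.neighborSet v) =>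
        min (flowValue T w r u) (w s(u, v))) u hu
    have key := min_flowValue_bottleneck_le hle (p.val.mapLe hT'G)
    rwa [flowValue_self, top_inf_eq, bottleneck, SimpleGraph.Walk.edges_mapLe_eq_edges,
      ← bottleneck] at key
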